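/- arXiv:2110.09122 — 3 statements merged into one kernel-verified Lean document; each statement's English description precedes it below -/
import Mathlib

section
/- Let A be a group and let G be a subgroup of the automorphism group Aut(A), acting on A in the natural way. If this action is nilpotent, i.e. Γ_G^r(A) is the trivial subgroup for some r ≥ 0, then G is a nilpotent group. -/
/-- The `G`-commutator subgroups `Γ_G^n(A)` for a subgroup `G` of the automorphism
group `Aut(A)` of a group `A`, acting on `A` in the natural way:
`Γ_G^0(A) = A` and `Γ_G^{n+1}(A)` is generated by the elements
`[g,a] = (g • a) * a⁻¹` with `g ∈ G` and `a ∈ Γ_G^n(A)`. -/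
def gammaAut (A : Type*) [Group A] (G : Subgroup (MulAut A)) : ℕ → Subgroup A
  | 0 => ⊤
  | n + 1 => Subgroup.closure {x : A | ∃ g ∈ G, ∃ a ∈ gammaAut A G n, x = g a * a⁻¹}

section

variable {A : Type*} [Group A] {G : Subgroup (MulAut A)}

theorem apply_mul_inv_mem_gammaAut_succ {n : ℕ} {g : MulAut A} (hg : g ∈ G) {a : A}
    (ha : a ∈ gammaAut A G n) : g a * a⁻¹ ∈ gammaAut A G (n + 1) :=
  Subgroup.subset_closure ⟨g, hg, a, ha, rfl⟩

theorem gammaAut_succ_le (n : ℕ) : gammaAut A G (n + 1) ≤ gammaAut A G n := by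
  induction n with
  | zero => exact le_top
  | succ n ih =>
    refine (Subgroup.closure_le _).2 ?_
    rintro _ ⟨g, hg, a, ha, rfl⟩
    exact apply_mul_inv_mem_gammaAut_succ hg (ih ha)

theorem gammaAut_antitone : Antitone (gammaAut A G) :=
  antitone_nat_of_succ_le gammaAut_succ_le

theorem conj_mem_gammaAut_succ {n : ℕ} {a x : A} (ha : a ∈ gammaAut A G n)
    (hx : x ∈ gammaAut A G (n + 1)) : a * x * a⁻¹ ∈ gammaAut A G (n + 1) := by
  have h : gammaAut A G (n + 1) ≤
      (gammaAut A G (n + 1)).comap (MulAut.conj a).toMonoidHom := by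
    refine (Subgroup.closure_le _).2 ?_
    rintro _ ⟨g, hg, b, hb, rfl⟩
    have key : a * (g b * b⁻¹) * a⁻¹ = (g a * a⁻¹)⁻¹ * (g (a * b) * (a * b)⁻¹) := by
      simp only [map_mul]
      group
    change a * (g b * b⁻¹) * a⁻¹ ∈ gammaAut A G (n + 1)
    rw [key]
    exact mul_mem (inv_mem (apply_mul_inv_mem_gammaAut_succ hg ha))
      (apply_mul_inv_mem_gammaAut_succ hg (mul_mem ha hb))
  exact h hx

/-- The automorphisms that fix `B` pointwise and move each element of `N` by an element of
`B ⊓ K`. -/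
def relativeStabilizer (N B K : Subgroup A) : Subgroup (MulAut A) where
  carrier := {c | (∀ b ∈ B, c b = b) ∧ ∀ a ∈ N, c a * a⁻¹ ∈ B ⊓ K}
  one_mem' := ⟨fun _ _ => rfl, fun a _ => by simp [one_mem]⟩
  mul_mem' := by
    rintro c d ⟨hc, hc'⟩ ⟨hd, hd'⟩
    refine ⟨fun b hb => by rw [MulAut.mul_apply, hd b hb, hc b hb], fun a ha => ?_⟩
    have h : (c * d) a * a⁻¹ = (d a * a⁻¹) * (c a * a⁻¹) := by
      conv_rhs => rw [← hc _ (hd' a ha).1]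
      simp [mul_assoc]
    rw [h]
    exact mul_mem (hd' a ha) (hc' a ha)
  inv_mem' := by
    rintro c ⟨hc, hc'⟩
    have hi : ∀ b ∈ B, c⁻¹ b = b := fun b hb => by
      conv_lhs => rw [← hc b hb]
      exact MulAut.inv_apply_self A c b
    refine ⟨hi, fun a ha => ?_⟩
    have h : c⁻¹ a * a⁻¹ = (c a * a⁻¹)⁻¹ := by
      rw [← hi _ (inv_mem (hc' a ha).1)]
      simp
    rw [h]
    exact inv_mem (hc' a ha)

theorem commutator_relativeStabilizer_le (j k : ℕ) :
    ⁅relativeStabilizer (gammaAut A G j) (gammaAut A G (j + 1)) (gammaAut A G (j + 1 + k)), G⁆ ≤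
      relativeStabilizer (gammaAut A G j) (gammaAut A G (j + 1))
        (gammaAut A G (j + 1 + (k + 1))) := by
  refine Subgroup.commutator_le.2 fun c hc g hg => ?_
  have hmap : ∀ h ∈ G, ∀ b ∈ gammaAut A G (j + 1), h b ∈ gammaAut A G (j + 1) :=
    fun h hh b hb => by
      simpa using mul_mem (gammaAut_succ_le _ (apply_mul_inv_mem_gammaAut_succ hh hb)) hb
  obtain ⟨hd, hd'⟩ := inv_mem hc
  refine ⟨fun b hb => ?_, fun a ha => ?_⟩
  · have h := hmap _ (inv_mem hg) b hb
    simp only [commutatorElement_def, MulAut.mul_apply]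
    rw [hd _ h, MulAut.apply_inv_self, hc.1 b hb]
  · obtain ⟨z, hz⟩ : ∃ z, z = c⁻¹ a * a⁻¹ := ⟨_, rfl⟩
    obtain ⟨b, hb⟩ : ∃ b, b = g⁻¹ a * a⁻¹ := ⟨_, rfl⟩
    have hzm := hd' a ha
    rw [← hz] at hzm
    have hbm : b ∈ gammaAut A G (j + 1) :=
      hb ▸ apply_mul_inv_mem_gammaAut_succ (inv_mem hg) ha
    have hda : c⁻¹ a = z * a := by simp [hz]
    have hga : g⁻¹ a = b * a := by simp [hb]
    have hca : c a = z⁻¹ * a := by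
      have h := congrArg c hda
      rw [MulAut.apply_inv_self, map_mul, hc.1 z hzm.1] at h
      rw [eq_inv_mul_iff_mul_eq, ← h]
    -- `c⁻¹` fixes both `b` and its conjugate by `a`, so `z` commutes with `b`
    have hzb : b * z = z * b := by
      have h := hd _ (by simpa using conj_mem_gammaAut_succ (inv_mem ha) hbm :
        a⁻¹ * b * a ∈ gammaAut A G (j + 1))
      simp only [map_mul, map_inv, hda, hd b hbm] at h
      have h' : z⁻¹ * b * z = b := by
        calc z⁻¹ * b * z = a * ((z * a)⁻¹ * b * (z * a)) * a⁻¹ := by group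
          _ = b := by rw [h]; group
      rw [mul_assoc, inv_mul_eq_iff_eq_mul] at h'
      exact h'
    have hfin : (c * g * c⁻¹ * g⁻¹) a = g z * z⁻¹ * a := by
      simp only [MulAut.mul_apply]
      rw [hga, map_mul, hd b hbm, hda, ← mul_assoc, hzb, mul_assoc, ← hga, map_mul,
        MulAut.apply_inv_self, map_mul, hca, hc.1 _ (hmap g hg z hzm.1), mul_assoc]
    rw [commutatorElement_def, hfin, mul_inv_cancel_right]
    exact ⟨gammaAut_succ_le _ (apply_mul_inv_mem_gammaAut_succ hg hzm.1),
      apply_mul_inv_mem_gammaAut_succ hg hzm.2⟩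

theorem exists_lowerCentralSeries_fixes_gammaAut {r : ℕ} (hr : gammaAut A G r = ⊥) (k : ℕ) :
    ∃ n, ∀ c ∈ G.lowerCentralSeries n, ∀ a ∈ gammaAut A G (r - k), c a = a := by
  induction k with
  | zero =>
    refine ⟨0, fun c _ a ha => ?_⟩
    rw [Nat.sub_zero, hr, Subgroup.mem_bot] at ha
    rw [ha, map_one]
  | succ k ih =>
    obtain ⟨n, hn⟩ := ih
    obtain hk | hk := Nat.lt_or_ge k r
    · obtain ⟨j, hj⟩ : ∃ j, j = r - (k + 1) := ⟨_, rfl⟩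
      rw [show r - k = j + 1 by omega] at hn
      rw [← hj]
      have hle : ∀ i, G.lowerCentralSeries (n + i) ≤ relativeStabilizer (gammaAut A G j)
          (gammaAut A G (j + 1)) (gammaAut A G (j + 1 + i)) := by
        intro i
        induction i with
        | zero =>
          refine fun c hc => ⟨hn c hc, fun a ha => ?_⟩
          have h := apply_mul_inv_mem_gammaAut_succ (G.lowerCentralSeries_le_self n hc) ha
          exact ⟨h, h⟩
        | succ i ih =>
          exact (Subgroup.commutator_mono ih le_rfl).trans (commutator_relativeStabilizer_le j i)
      refine ⟨n + r, fun c hc a ha => ?_⟩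
      have h := gammaAut_antitone (by omega : r ≤ j + 1 + r) ((hle r hc).2 a ha).2
      rwa [hr, Subgroup.mem_bot, mul_inv_eq_one] at h
    · exact ⟨n, by rwa [show r - (k + 1) = r - k by omega]⟩

end

/-- P. Hall's theorem: if a subgroup `G ≤ Aut(A)` acts nilpotently on `A`
(i.e. `Γ_G^r(A)` is trivial for some `r`), then `G` is a nilpotent group. -/
theorem hall_nilpotent_of_nilpotent_action {A : Type*} [Group A] (G : Subgroup (MulAut A))
    (h : ∃ r : ℕ, gammaAut A G r = ⊥) : Group.IsNilpotent ↥G := by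
  obtain ⟨r, hr⟩ := h
  obtain ⟨n, hn⟩ := exists_lowerCentralSeries_fixes_gammaAut hr r
  rw [Nat.sub_self] at hn
  refine Subgroup.isNilpotent_of_lowerCentralSeries_eq_bot (n := n) ?_
  exact (Subgroup.eq_bot_iff_forall _).2 fun c hc =>
    MulEquiv.ext fun a => hn c hc a (Subgroup.mem_top a)
end

section
/- Let G be a group acting by additive automorphisms on additive abelian groups M and N, and let G act on the abelian group Hom(M,N) of additive homomorphisms by conjugation, (g • f)(m) = g • f(g⁻¹ • m). If the actions of G on M and on N are both nilpotent, then the conjugation action of G on Hom(M,N) is nilpotent; moreover nil_G(Hom(M,N)) ≤ 2s, where s = max{nil_G(M), nil_G(N)}. -/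
/-- The `G`-commutator subgroups `Γ_G^n(M)` for a group `G` acting by additive
automorphisms on an additive abelian group `M`:
`Γ_G^0(M) = M` and `Γ_G^{n+1}(M)` is generated by the elements
`[g,m] = g • m - m` with `g ∈ G` and `m ∈ Γ_G^n(M)`. -/
def aGamma (G : Type*) [Group G] (M : Type*) [AddCommGroup M] [DistribMulAction G M] :
    ℕ → AddSubgroup M
  | 0 => ⊤
  | n + 1 => AddSubgroup.closure {x : M | ∃ g : G, ∃ m ∈ aGamma G M n, x = g • m - m}

/-- `nil_G(M)`: the least `r` such that `Γ_G^r(M) = 0`. -/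
noncomputable def nilA (G : Type*) [Group G] (M : Type*) [AddCommGroup M]
    [DistribMulAction G M] : ℕ :=
  sInf {r : ℕ | aGamma G M r = ⊥}

/-- The conjugation action of `G` on `Hom(M,N)`: `(g • f)(m) = g • f(g⁻¹ • m)`. -/
def conjAction (G : Type*) [Group G] (M N : Type*) [AddCommGroup M] [AddCommGroup N]
    [DistribMulAction G M] [DistribMulAction G N] : DistribMulAction G (M →+ N) where
  smul g f :=
    { toFun := fun m => g • f (g⁻¹ • m)
      map_zero' := by simp
      map_add' := by intro a b; simp [smul_add] }
  one_smul f := by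
    ext m
    show (1 : G) • f ((1 : G)⁻¹ • m) = f m
    simp
  mul_smul g h f := by
    ext m
    show (g * h) • f ((g * h)⁻¹ • m) = g • (h • f (h⁻¹ • (g⁻¹ • m)))
    simp [mul_smul]
  smul_zero g := by
    ext m
    show g • ((0 : M →+ N) (g⁻¹ • m)) = 0
    simp
  smul_add g f h := by
    ext m
    show g • ((f + h) (g⁻¹ • m)) = g • f (g⁻¹ • m) + g • h (g⁻¹ • m)
    simp

section Gamma

variable {G M N : Type*} [Group G] [AddCommGroup M] [AddCommGroup N]
  [DistribMulAction G M] [DistribMulAction G N]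

theorem smul_sub_mem_aGamma_succ {n : ℕ} {m : M} (g : G) (hm : m ∈ aGamma G M n) :
    g • m - m ∈ aGamma G M (n + 1) :=
  AddSubgroup.subset_closure ⟨g, m, hm, rfl⟩

theorem aGamma_antitone : Antitone (aGamma G M) := by
  refine antitone_nat_of_succ_le fun n => ?_
  induction n with
  | zero => exact le_top
  | succ n ih =>
    refine AddSubgroup.closure_mono ?_
    rintro x ⟨g, m, hm, rfl⟩
    exact ⟨g, m, ih hm, rfl⟩

theorem smul_mem_aGamma {n : ℕ} {m : M} (g : G) (hm : m ∈ aGamma G M n) :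
    g • m ∈ aGamma G M n := by
  have h := add_mem (aGamma_antitone n.le_succ (smul_sub_mem_aGamma_succ g hm)) hm
  rwa [sub_add_cancel] at h

/-- Elements of `Γ_G^n(Hom(M,N))` shift the commutator filtrations by `n + 1 - r`
if `Γ_G^r(M) = 0`. -/
theorem apply_mem_aGamma_of_mem_aGamma_conjAction {r : ℕ} (hr : aGamma G M r = ⊥) {n : ℕ}
    {f : M →+ N} (hf : f ∈ @aGamma G _ (M →+ N) _ (conjAction G M N) n)
    {i : ℕ} {m : M} (hm : m ∈ aGamma G M i) :
    f m ∈ aGamma G N (i + n + 1 - r) := by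
  induction n generalizing f i m with
  | zero =>
    rcases lt_or_ge i r with h | h
    · rw [show i + 0 + 1 - r = 0 by omega]
      exact AddSubgroup.mem_top _
    · have hm0 : m ∈ (⊥ : AddSubgroup M) := hr ▸ aGamma_antitone h hm
      rw [AddSubgroup.mem_bot.mp hm0, map_zero]
      exact zero_mem _
  | succ n ih =>
    refine AddSubgroup.closure_induction
      (p := fun (f : M →+ N) _ => f m ∈ aGamma G N (i + (n + 1) + 1 - r))
      ?_ (zero_mem _) (fun _ _ _ _ => add_mem) (fun _ _ => neg_mem) hf
    rintro _ ⟨g, f, hf, rfl⟩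
    change g • f (g⁻¹ • m) - f m ∈ _
    have h₁ := smul_sub_mem_aGamma_succ g (ih hf (smul_mem_aGamma g⁻¹ hm))
    have h₂ := ih hf (smul_sub_mem_aGamma_succ g⁻¹ hm)
    have h := add_mem (aGamma_antitone (by omega : i + (n + 1) + 1 - r ≤ _) h₁)
      (aGamma_antitone (by omega : i + (n + 1) + 1 - r ≤ _) h₂)
    rwa [map_sub, sub_add_sub_cancel] at h

theorem aGamma_conjAction_eq_bot {r t n : ℕ} (hr : aGamma G M r = ⊥) (ht : aGamma G N t = ⊥)
    (hn : r + t ≤ n + 1) : @aGamma G _ (M →+ N) _ (conjAction G M N) n = ⊥ := by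
  refine (AddSubgroup.eq_bot_iff_forall _).mpr fun f hf => ?_
  ext m
  have h := apply_mem_aGamma_of_mem_aGamma_conjAction hr hf
    (show m ∈ aGamma G M 0 from AddSubgroup.mem_top m)
  have h' := aGamma_antitone (by omega : t ≤ 0 + n + 1 - r) h
  rw [ht] at h'
  exact AddSubgroup.mem_bot.mp h'

end Gamma

/-- If `G` acts nilpotently on abelian groups `M` and `N`, then the conjugation action
of `G` on `Hom(M,N)` is nilpotent, and `nil_G(Hom(M,N)) ≤ 2s` with
`s = max {nil_G(M), nil_G(N)}`. -/
theorem conj_action_nilpotent {G M N : Type*} [Group G] [AddCommGroup M] [AddCommGroup N]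
    [DistribMulAction G M] [DistribMulAction G N]
    (hM : ∃ r : ℕ, aGamma G M r = ⊥) (hN : ∃ r : ℕ, aGamma G N r = ⊥) :
    (∃ r : ℕ, @aGamma G _ (M →+ N) _ (conjAction G M N) r = ⊥) ∧
      @nilA G _ (M →+ N) _ (conjAction G M N) ≤ 2 * max (nilA G M) (nilA G N) := by
  have h : @aGamma G _ (M →+ N) _ (conjAction G M N) (2 * max (nilA G M) (nilA G N)) = ⊥ :=
    aGamma_conjAction_eq_bot (r := nilA G M) (t := nilA G N) (Nat.sInf_mem hM)
      (Nat.sInf_mem hN) (by omega)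
  exact ⟨⟨_, h⟩, Nat.sInf_le h⟩
end

section
/- Let G be a group acting on a group B by automorphisms and let A be a normal, G-invariant subgroup of B. If the restricted action of G on A is nilpotent of order ≤ r and the induced action of G on the quotient group B/A is nilpotent of order ≤ s, then the action of G on B is nilpotent, and nil_G(B) ≤ r + s. -/
/-- The relative `G`-commutator subgroups of a subgroup `S ≤ B`, for a group `G` acting
on `B` by automorphisms: `Γ_G^0(S) = S` and `Γ_G^{n+1}(S)` is generated by the elements
`[g,b] = (g • b) * b⁻¹` with `g ∈ G` and `b ∈ Γ_G^n(S)`.  When `S` is `G`-invariant this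
computes, inside `B`, the `G`-commutator subgroups of the restricted action on `S`;
for `S = ⊤` it computes `Γ_G^n(B)`. -/
def gammaFrom (G : Type*) [Group G] {B : Type*} [Group B] [MulDistribMulAction G B]
    (S : Subgroup B) : ℕ → Subgroup B
  | 0 => S
  | n + 1 => Subgroup.closure {x : B | ∃ g : G, ∃ b ∈ gammaFrom G S n, x = g • b * b⁻¹}

/-- The `G`-commutator subgroups `Γ_G^n(B)` of the action of `G` on `B`. -/
def gammaG (G : Type*) [Group G] (B : Type*) [Group B] [MulDistribMulAction G B] :
    ℕ → Subgroup B :=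
  gammaFrom G (⊤ : Subgroup B)

theorem gammaFrom_mono {G B : Type*} [Group G] [Group B] [MulDistribMulAction G B]
    {S T : Subgroup B} (h : S ≤ T) (n : ℕ) : gammaFrom G S n ≤ gammaFrom G T n := by
  induction n with
  | zero => exact h
  | succ n ih =>
    refine Subgroup.closure_mono ?_
    rintro x ⟨g, b, hb, rfl⟩
    exact ⟨g, b, ih hb, rfl⟩

theorem gammaFrom_add {G B : Type*} [Group G] [Group B] [MulDistribMulAction G B]
    (S : Subgroup B) (m n : ℕ) :
    gammaFrom G S (m + n) = gammaFrom G (gammaFrom G S n) m := by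
  induction m with
  | zero => rw [Nat.zero_add]; rfl
  | succ m ih => rw [Nat.succ_add, gammaFrom, gammaFrom, ih]

/-- An equivariant homomorphism maps `G`-commutator subgroups into `G`-commutator subgroups. -/
theorem gammaFrom_le_comap {G B C : Type*} [Group G] [Group B] [Group C]
    [MulDistribMulAction G B] [MulDistribMulAction G C] (f : B →* C)
    (hf : ∀ (g : G) (b : B), f (g • b) = g • f b) {S : Subgroup B} {T : Subgroup C}
    (h : S ≤ T.comap f) (n : ℕ) : gammaFrom G S n ≤ (gammaFrom G T n).comap f := by
  induction n with
  | zero => exact h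
  | succ n ih =>
    refine (Subgroup.closure_le _).2 ?_
    rintro x ⟨g, b, hb, rfl⟩
    exact Subgroup.subset_closure ⟨g, f b, ih hb, by rw [map_mul, map_inv, hf]⟩

/-- If `A` is a normal `G`-invariant subgroup of `B`, the restricted action of `G` on `A`
is nilpotent of order `≤ r`, and the induced action of `G` on the quotient `B ⧸ A`
(characterized by the equivariance of the projection) is nilpotent of order `≤ s`,
then the action of `G` on `B` is nilpotent and `nil_G(B) ≤ r + s`. -/
theorem gamma_extension_nilpotent {G B : Type*} [Group G] [Group B] [MulDistribMulAction G B]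
    (A : Subgroup B) [A.Normal] (hInv : ∀ (g : G), ∀ a ∈ A, g • a ∈ A)
    [MulDistribMulAction G (B ⧸ A)]
    (hcompat : ∀ (g : G) (b : B), g • ((b : B ⧸ A)) = (((g • b : B) : B ⧸ A)))
    (r s : ℕ)
    (hA : gammaFrom G A r = ⊥)
    (hQ : gammaG G (B ⧸ A) s = ⊥) :
    gammaG G B (r + s) = ⊥ ∧ sInf {n : ℕ | gammaG G B n = ⊥} ≤ r + s := by
  have hs : gammaG G B s ≤ A := by
    have h := gammaFrom_le_comap (G := G) (QuotientGroup.mk' A) (fun g b => (hcompat g b).symm)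
      (S := ⊤) (T := ⊤) le_top s
    change gammaG G B s ≤ (gammaG G (B ⧸ A) s).comap _ at h
    rwa [hQ, MonoidHom.comap_bot, QuotientGroup.ker_mk'] at h
  have hrs : gammaG G B (r + s) = ⊥ := by
    rw [eq_bot_iff, ← hA, gammaG, gammaFrom_add]
    exact gammaFrom_mono hs r
  exact ⟨hrs, Nat.sInf_le hrs⟩
end
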